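/- Let K be an algebraically closed field of characteristic 0 and let d ≥ 4. Let L ⊆ Sym^d be the K-span of the set {s^{d−j}·t^{j} : 1 ≤ j ≤ d−2} ∪ {s^d + t^d}. Then for every Q = (α, β) ∈ K × K with (α, β) ≠ (0, 0), the value semigroup S(L, Q) is NOT finitely generated; that is, there exists no homogeneous valuation which is Khovanskii-finite with respect to R(L). (Example 4.10 of the paper, main claim.) -/

import Mathlib

open MvPolynomial Filter

noncomputable section

variable {K : Type} [Field K]

/-- The linear form `β·s − α·t` in `K[s,t]`, cutting out the point `Q = (α : β)` of `ℙ¹`. -/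
def lform (α β : K) : MvPolynomial (Fin 2) K := C β * X 0 - C α * X 1

/-- The value semigroup `S(L, Q) = {(k, ord_Q f) : f ∈ L^k, f ≠ 0}` of the homogeneous
valuation `ν_Q` on `R(L) = ⨁ₖ L^k`, where `ord_Q f` is the largest `e` such that
`(β·s − α·t)^e` divides `f`. -/
def curveValueSemigroup (L : Submodule K (MvPolynomial (Fin 2) K)) (α β : K) :
    AddSubmonoid (ℤ × ℤ) :=
  AddSubmonoid.closure
    {p | ∃ (k e : ℕ) (f : MvPolynomial (Fin 2) K), f ∈ L ^ k ∧ f ≠ 0 ∧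
      (lform α β) ^ e ∣ f ∧ ¬ (lform α β) ^ (e + 1) ∣ f ∧ p = ((k : ℤ), (e : ℤ))}

/-- The span of `{s^{d-j}·t^j : 1 ≤ j ≤ d-2} ∪ {s^d + t^d}`. -/
def nodeCuspSpace (K : Type) [Field K] (d : ℕ) : Submodule K (MvPolynomial (Fin 2) K) :=
  Submodule.span K
    (((fun j : ℕ => X 0 ^ (d - j) * X 1 ^ j) '' {j | 1 ≤ j ∧ j ≤ d - 2}) ∪
      {(X 0 ^ d + X 1 ^ d : MvPolynomial (Fin 2) K)})

theorem monomial_mem_nodeCuspSpace {d a b : ℕ} (hab : a + b = d) (ha : 2 ≤ a) (hb : 1 ≤ b) :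
    (X 0 ^ a * X 1 ^ b : MvPolynomial (Fin 2) K) ∈ nodeCuspSpace K d := by
  refine Submodule.subset_span (Or.inl ⟨b, ⟨hb, by omega⟩, ?_⟩)
  simp only [show d - b = a by omega]

theorem add_pow_mem_nodeCuspSpace (d : ℕ) :
    (X 0 ^ d + X 1 ^ d : MvPolynomial (Fin 2) K) ∈ nodeCuspSpace K d :=
  Submodule.subset_span (Or.inr rfl)

/-- Away from the ends, every monomial of degree `k * d` lies in the `k`-th power. -/
theorem monomial_mem_nodeCuspSpace_pow {d : ℕ} (hd : 4 ≤ d) {k : ℕ} (hk : 2 ≤ k) :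
    ∀ a b : ℕ, a + b = k * d → 4 ≤ a → 2 ≤ b →
      (X 0 ^ a * X 1 ^ b : MvPolynomial (Fin 2) K) ∈ nodeCuspSpace K d ^ k := by
  induction k, hk using Nat.le_induction with
  | base =>
    intro a b hab ha hb
    obtain ⟨u, hu⟩ : ∃ u, u = min (a - 2) (d - 1) := ⟨_, rfl⟩
    have hmem := Submodule.mul_mem_mul
      (monomial_mem_nodeCuspSpace (K := K) (d := d) (a := u) (b := d - u)
        (by omega) (by omega) (by omega))
      (monomial_mem_nodeCuspSpace (K := K) (d := d) (a := a - u) (b := b - (d - u))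
        (by omega) (by omega) (by omega))
    rw [pow_two]
    convert hmem using 1
    rw [mul_mul_mul_comm, ← pow_add, ← pow_add]
    congr 2 <;> omega
  | succ k hk ih =>
    have hkd : 2 * d ≤ k * d := Nat.mul_le_mul_right d hk
    have hsucc : (k + 1) * d = k * d + d := by ring
    have inner : ∀ a b : ℕ, a + b = (k + 1) * d → 6 ≤ a → 3 ≤ b →
        (X 0 ^ a * X 1 ^ b : MvPolynomial (Fin 2) K) ∈ nodeCuspSpace K d ^ (k + 1) := by
      intro a b hab ha hb
      obtain ⟨u, hu⟩ : ∃ u, u = min (a - 4) (d - 1) := ⟨_, rfl⟩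
      have hmem := Submodule.mul_mem_mul
        (ih (a - u) (b - (d - u)) (by omega) (by omega) (by omega))
        (monomial_mem_nodeCuspSpace (K := K) (d := d) (a := u) (b := d - u)
          (by omega) (by omega) (by omega))
      rw [pow_succ]
      convert hmem using 1
      rw [mul_mul_mul_comm, ← pow_add, ← pow_add]
      congr 2 <;> omega
    intro a b hab ha hb
    rcases Nat.lt_or_ge a 6 with ha6 | ha6
    · have hmem := Submodule.mul_mem_mul
        (ih a (b - d) (by omega) (by omega) (by omega)) (add_pow_mem_nodeCuspSpace (K := K) d)
      rw [← pow_succ] at hmem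
      have hin := inner (a + d) (b - d) (by omega) (by omega) (by omega)
      convert sub_mem hmem hin using 1
      obtain ⟨c, rfl⟩ : ∃ c, b = c + d := ⟨b - d, by omega⟩
      rw [Nat.add_sub_cancel]
      ring
    · rcases Nat.lt_or_ge b 3 with hb3 | hb3
      · have hmem := Submodule.mul_mem_mul
          (ih (a - d) b (by omega) (by omega) (by omega)) (add_pow_mem_nodeCuspSpace (K := K) d)
        rw [← pow_succ] at hmem
        have hin := inner (a - d) (b + d) (by omega) (by omega) (by omega)
        convert sub_mem hmem hin using 1
        obtain ⟨c, rfl⟩ : ∃ c, a = c + d := ⟨a - d, by omega⟩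
        rw [Nat.add_sub_cancel]
        ring
      · exact inner a b hab ha6 hb3

theorem mul_lform_pow_mem_nodeCuspSpace_pow {d : ℕ} (hd : 4 ≤ d) {k : ℕ} (hk : 2 ≤ k) (α β : K) :
    X 0 ^ 4 * X 1 ^ 2 * lform α β ^ (k * d - 6) ∈ nodeCuspSpace K d ^ k := by
  have hkd : 2 * d ≤ k * d := Nat.mul_le_mul_right d hk
  rw [lform, sub_eq_add_neg, add_pow, Finset.mul_sum]
  refine Submodule.sum_mem _ fun m hm => ?_
  have hm' := Finset.mem_range.mp hm
  have hmem := Submodule.smul_mem _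
    (β ^ m * (-α) ^ (k * d - 6 - m) * ((k * d - 6).choose m : K))
    (monomial_mem_nodeCuspSpace_pow (K := K) hd hk (m + 4) (k * d - 6 - m + 2)
      (by omega) (by omega) (by omega))
  convert hmem using 1
  rw [smul_eq_C_mul, ← neg_mul, ← C_neg, mul_pow, mul_pow]
  simp only [map_mul, map_pow, map_natCast]
  ring

/-- Elements of the `k`-th power are homogeneous, take equal values at `(1, 0)` and `(0, 1)`, and
have vanishing `s`-derivative at `(0, 1)`. -/
theorem conditions_of_mem_nodeCuspSpace_pow {d : ℕ} (hd : 4 ≤ d) {k : ℕ}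
    {f : MvPolynomial (Fin 2) K} (hf : f ∈ nodeCuspSpace K d ^ k) :
    f.IsHomogeneous (k * d) ∧ eval ![1, 0] f = eval ![0, 1] f ∧
      eval ![0, 1] (pderiv 0 f) = 0 := by
  have base : ∀ g ∈ nodeCuspSpace K d, g.IsHomogeneous d ∧ eval ![1, 0] g = eval ![0, 1] g ∧
      eval ![0, 1] (pderiv 0 g) = 0 := by
    intro g hg
    induction hg using Submodule.span_induction with
    | mem x hx =>
      rcases hx with ⟨j, ⟨hj1, hj2⟩, rfl⟩ | rfl
      · refine ⟨?_, ?_, ?_⟩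
        · have h := ((isHomogeneous_X K (0 : Fin 2)).pow (d - j)).mul
            ((isHomogeneous_X K (1 : Fin 2)).pow j)
          rwa [one_mul, one_mul, Nat.sub_add_cancel (by omega)] at h
        · simp [show j ≠ 0 by omega, show d - j ≠ 0 by omega]
        · simp [pderiv_X, Derivation.leibniz, Derivation.leibniz_pow,
            show d - j - 1 ≠ 0 by omega]
      · refine ⟨?_, ?_, ?_⟩
        · have h0 := (isHomogeneous_X K (0 : Fin 2)).pow d
          have h1 := (isHomogeneous_X K (1 : Fin 2)).pow d
          rw [one_mul] at h0 h1
          exact h0.add h1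
        · simp [show d ≠ 0 by omega]
        · simp [pderiv_X, Derivation.leibniz_pow, show d - 1 ≠ 0 by omega]
    | zero => exact ⟨isHomogeneous_zero _ _ _, by simp, by simp⟩
    | add x y _ _ hx hy =>
      exact ⟨hx.1.add hy.1, by simp [hx.2.1, hy.2.1], by simp [hx.2.2, hy.2.2]⟩
    | smul c x _ hx =>
      refine ⟨?_, by simp [smul_eval, hx.2.1], by simp [smul_eval, hx.2.2]⟩
      rw [smul_eq_C_mul]
      simpa using (isHomogeneous_C (Fin 2) c).mul hx.1
  induction hf using Submodule.pow_induction_on_left' with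
  | algebraMap r =>
    rw [algebraMap_eq, zero_mul]
    exact ⟨isHomogeneous_C _ _, by simp, by simp⟩
  | add x y i _ _ hx hy =>
    exact ⟨hx.1.add hy.1, by simp [hx.2.1, hy.2.1], by simp [hx.2.2, hy.2.2]⟩
  | mem_mul m hm i x _ hx =>
    obtain ⟨h1, h2, h3⟩ := base m hm
    refine ⟨?_, by simp [h2, hx.2.1], by simp [Derivation.leibniz, h3, hx.2.2]⟩
    have h := h1.mul hx.1
    rwa [show d + i * d = i.succ * d by rw [Nat.succ_mul, add_comm]] at h

theorem isHomogeneous_lform (α β : K) : (lform α β).IsHomogeneous 1 := by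
  have h0 := (isHomogeneous_C (Fin 2) β).mul (isHomogeneous_X K (0 : Fin 2))
  have h1 := (isHomogeneous_C (Fin 2) α).mul (isHomogeneous_X K (1 : Fin 2))
  rw [zero_add] at h0 h1
  exact h0.sub h1

theorem lform_ne_zero {α β : K} (h : (α, β) ≠ ((0 : K), (0 : K))) : lform α β ≠ 0 := by
  intro h0
  have hβ := congrArg (eval ![1, 0]) h0
  have hα := congrArg (eval ![0, 1]) h0
  simp only [lform, map_sub, map_mul, eval_C, eval_X, map_zero] at hα hβ
  simp at hα hβ
  exact h (by rw [hα, hβ])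

theorem totalDegree_lform_pow_mul {α β : K} (h : (α, β) ≠ ((0 : K), (0 : K))) (e : ℕ)
    {g : MvPolynomial (Fin 2) K} (hg : g ≠ 0) :
    (lform α β ^ e * g).totalDegree = e + g.totalDegree := by
  have hl := lform_ne_zero h
  rw [totalDegree_mul_of_isDomain (pow_ne_zero e hl) hg,
    ((isHomogeneous_lform α β).pow e).totalDegree (pow_ne_zero e hl), one_mul]

theorem le_totalDegree_of_lform_pow_dvd {α β : K} (h : (α, β) ≠ ((0 : K), (0 : K))) {e : ℕ}
    {f : MvPolynomial (Fin 2) K} (hf : f ≠ 0) (hdvd : lform α β ^ e ∣ f) :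
    e ≤ f.totalDegree := by
  obtain ⟨g, rfl⟩ := hdvd
  rw [totalDegree_lform_pow_mul h e (right_ne_zero_of_mul hf)]
  exact Nat.le_add_right _ _

/-- The order at `Q` of a nonzero element of the `k`-th power is smaller than its degree. -/
theorem lt_of_lform_pow_dvd [CharZero K] {d : ℕ} (hd : 4 ≤ d) {α β : K}
    (h : (α, β) ≠ ((0 : K), (0 : K))) {k e : ℕ} (hk : k ≠ 0) {f : MvPolynomial (Fin 2) K}
    (hf : f ∈ nodeCuspSpace K d ^ k) (hf0 : f ≠ 0) (hdvd : lform α β ^ e ∣ f) : e < k * d := by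
  obtain ⟨hhom, hval, hder⟩ := conditions_of_mem_nodeCuspSpace_pow hd hf
  have hle := le_totalDegree_of_lform_pow_dvd h hf0 hdvd
  rw [hhom.totalDegree hf0] at hle
  refine lt_of_le_of_ne hle fun he => ?_
  obtain ⟨g, rfl⟩ := hdvd
  have hg0 := right_ne_zero_of_mul hf0
  have hdeg := totalDegree_lform_pow_mul h e hg0
  rw [hhom.totalDegree hf0] at hdeg
  obtain ⟨c, rfl⟩ : ∃ c, g = C c := ⟨_, totalDegree_eq_zero_iff_eq_C.mp (by omega)⟩
  have hc : c ≠ 0 := by rintro rfl; simp at hg0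
  have he4 : 4 ≤ e := he ▸ hd.trans (Nat.le_mul_of_pos_left d (Nat.pos_of_ne_zero hk))
  have hend : β ^ e = (-α) ^ e := by
    simpa [lform, hc] using hval
  have hprod : β = 0 ∨ α = 0 := by
    simp [lform, pderiv_X, Derivation.leibniz, Derivation.leibniz_pow, hc,
      show e ≠ 0 by omega, show e - 1 ≠ 0 by omega] at hder
    tauto
  have he0 : e ≠ 0 := by omega
  rcases hprod with rfl | rfl
  · rw [zero_pow he0, eq_comm, pow_eq_zero_iff he0, neg_eq_zero] at hend
    exact h (by rw [hend])
  · rw [neg_zero, zero_pow he0, pow_eq_zero_iff he0] at hend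
    exact h (by rw [hend])

theorem curveValueSemigroup_nodeCuspSpace_bound [CharZero K] {d : ℕ} (hd : 4 ≤ d) {α β : K}
    (h : (α, β) ≠ ((0 : K), (0 : K))) {p : ℤ × ℤ}
    (hp : p ∈ curveValueSemigroup (nodeCuspSpace K d) α β) :
    p = 0 ∨ (1 ≤ p.1 ∧ p.2 + 1 ≤ p.1 * d) := by
  induction hp using AddSubmonoid.closure_induction with
  | mem x hx =>
    obtain ⟨k, e, f, hf, hf0, hdvd, -, rfl⟩ := hx
    rcases Nat.eq_zero_or_pos k with rfl | hk
    · left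
      have hle := le_totalDegree_of_lform_pow_dvd h hf0 hdvd
      rw [(conditions_of_mem_nodeCuspSpace_pow hd hf).1.totalDegree hf0, zero_mul] at hle
      simp [Nat.le_zero.mp hle]
    · right
      have hlt := lt_of_lform_pow_dvd hd h hk.ne' hf hf0 hdvd
      dsimp only
      exact ⟨by exact_mod_cast hk, by exact_mod_cast hlt⟩
  | zero => exact Or.inl rfl
  | add x y _ _ hx hy =>
    rcases hx with rfl | hx
    · simpa using hy
    · rcases hy with rfl | hy
      · simpa using Or.inr hx
      · right
        simp only [Prod.fst_add, Prod.snd_add, add_mul]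
        omega

theorem exists_mem_curveValueSemigroup_nodeCuspSpace {d : ℕ} (hd : 4 ≤ d) {α β : K}
    (h : (α, β) ≠ ((0 : K), (0 : K))) {k : ℕ} (hk : 2 ≤ k) :
    ∃ e : ℕ, k * d ≤ e + 6 ∧ ((k : ℤ), (e : ℤ)) ∈ curveValueSemigroup (nodeCuspSpace K d) α β := by
  have hf0 : X 0 ^ 4 * X 1 ^ 2 * lform α β ^ (k * d - 6) ≠ 0 :=
    mul_ne_zero (mul_ne_zero (pow_ne_zero _ (X_ne_zero _)) (pow_ne_zero _ (X_ne_zero _)))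
      (pow_ne_zero _ (lform_ne_zero h))
  have hfin : FiniteMultiplicity (lform α β)
      (X 0 ^ 4 * X 1 ^ 2 * lform α β ^ (k * d - 6)) :=
    ⟨_, fun hdvd => Nat.not_succ_le_self _ (le_totalDegree_of_lform_pow_dvd h hf0 hdvd)⟩
  refine ⟨multiplicity (lform α β) (X 0 ^ 4 * X 1 ^ 2 * lform α β ^ (k * d - 6)), ?_,
    AddSubmonoid.subset_closure ⟨k, _, _, mul_lform_pow_mem_nodeCuspSpace_pow hd hk α β, hf0,
      pow_multiplicity_dvd _ _, hfin.not_pow_dvd_of_multiplicity_lt (Nat.lt_succ_self _), rfl⟩⟩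
  have := hfin.le_multiplicity_of_pow_dvd (dvd_mul_left (lform α β ^ (k * d - 6)) _)
  omega

/-- **Example 4.10, main claim.** Let `K` be an algebraically closed field of characteristic
`0`, `d ≥ 4`, and `L ⊆ Sym^d` the span of `{s^{d-j}·t^j : 1 ≤ j ≤ d-2} ∪ {s^d + t^d}`. Then
for every point `Q = (α : β)` of `ℙ¹`, the value semigroup `S(L, Q)` is not finitely
generated; i.e. no homogeneous valuation is Khovanskii-finite with respect to `R(L)`. -/
theorem example410_not_khovanskiiFinite [IsAlgClosed K] [CharZero K] (d : ℕ) (hd : 4 ≤ d) :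
    ∀ α β : K, (α, β) ≠ ((0 : K), (0 : K)) →
      ¬ (curveValueSemigroup
          (Submodule.span K
            (((fun j : ℕ => X 0 ^ (d - j) * X 1 ^ j) '' {j | 1 ≤ j ∧ j ≤ d - 2}) ∪
              {(X 0 ^ d + X 1 ^ d : MvPolynomial (Fin 2) K)}))
          α β).FG := by
  intro α β h hFG
  change (curveValueSemigroup (nodeCuspSpace K d) α β).FG at hFG
  obtain ⟨S, hS⟩ := hFG
  have hbound : ∀ p ∈ S, p = 0 ∨ (1 ≤ p.1 ∧ p.2 + 1 ≤ p.1 * d) := fun p hp =>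
    curveValueSemigroup_nodeCuspSpace_bound hd h (hS ▸ AddSubmonoid.subset_closure hp)
  obtain ⟨M, hM⟩ : ∃ M : ℕ, ∀ p ∈ S, p.1 ≤ M :=
    ⟨S.sup fun p => p.1.toNat, fun p hp =>
      (Int.self_le_toNat p.1).trans
        (by exact_mod_cast Finset.le_sup (f := fun p : ℤ × ℤ => p.1.toNat) hp)⟩
  have hslope : ∀ p ∈ AddSubmonoid.closure (S : Set (ℤ × ℤ)), M * p.2 + p.1 ≤ M * (p.1 * d) := by
    intro p hp
    induction hp using AddSubmonoid.closure_induction with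
    | mem x hx =>
      rcases hbound x hx with rfl | ⟨-, hx2⟩
      · simp
      · have := mul_le_mul_of_nonneg_left hx2 (Int.natCast_nonneg M)
        linarith [hM x hx]
    | zero => simp
    | add x y _ _ hx hy =>
      simp only [Prod.fst_add, Prod.snd_add]
      linarith
  obtain ⟨e, he, hmem⟩ :=
    exists_mem_curveValueSemigroup_nodeCuspSpace hd h (k := 6 * M + 2) (by omega)
  rw [← hS] at hmem
  have hle := hslope _ hmem
  have he' : ((6 * M + 2 : ℕ) : ℤ) * d ≤ e + 6 := by exact_mod_cast he
  have := mul_le_mul_of_nonneg_left he' (Int.natCast_nonneg M)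
  push_cast at hle this
  linarith

end
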